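/- (Almost-sure phase transition) Assume G is connected, E_neg is nonempty, the positive graph (V, E_pst) is connected, and p_ij + p_ji > 0 for every {i,j} ∈ E. Fix α ∈ (0,1) with α ≠ 1/2. Then: (i) there exists β^♮ > 0 (depending on α) such that for all 0 ≤ β < β^♮, ℙ(lim_{k→∞} W(k)W(k−1)⋯W(0) = U) = 1 (so for every initial x⁰, 𝔛(k) → 0 almost surely); (ii) there exists β^♯ > 0 (depending on α) such that for all β > β^♯ and every deterministic initial vector x⁰ with 𝔛(0) > 0, ℙ(liminf_{k→∞} 𝔛(k) = ∞) = 1. -/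

import Mathlib

open Matrix MeasureTheory Filter
open scoped ENNReal

noncomputable section

namespace SignedOpinion

/-- The vector `e i - e j` in `ℝⁿ`. -/
def esub {n : ℕ} (i j : Fin n) : Fin n → ℝ :=
  fun k => (if k = i then (1 : ℝ) else 0) - (if k = j then (1 : ℝ) else 0)

/-- The rank-one matrix `(e i - e j) (e i - e j)ᵀ`. -/
def dmatAux {n : ℕ} (i j : Fin n) : Matrix (Fin n) (Fin n) ℝ :=
  Matrix.vecMulVec (esub i j) (esub i j)

lemma dmatAux_symm {n : ℕ} (i j : Fin n) : dmatAux i j = dmatAux j i := by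
  ext a b
  simp only [dmatAux, esub, Matrix.vecMulVec_apply]
  ring

/-- `(e i - e j)(e i - e j)ᵀ` as a function of the unordered pair `{i, j}`. -/
def dmat {n : ℕ} : Sym2 (Fin n) → Matrix (Fin n) (Fin n) ℝ :=
  Sym2.lift ⟨dmatAux, dmatAux_symm⟩

/-- The averaging matrix `U = 𝟙𝟙ᵀ / n`. -/
def Umat (n : ℕ) : Matrix (Fin n) (Fin n) ℝ :=
  (n : ℝ)⁻¹ • Matrix.of (fun _ _ => (1 : ℝ))

/-- The positive update matrix `W⁺_{ij} = I - α (e i - e j)(e i - e j)ᵀ`. -/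
def Wpos {n : ℕ} (α : ℝ) (e : Sym2 (Fin n)) : Matrix (Fin n) (Fin n) ℝ :=
  1 - α • dmat e

/-- The negative update matrix `W⁻_{ij} = I + β (e i - e j)(e i - e j)ᵀ`. -/
def Wneg {n : ℕ} (β : ℝ) (e : Sym2 (Fin n)) : Matrix (Fin n) (Fin n) ℝ :=
  1 + β • dmat e

/-- The edge selection probability `μ({i,j}) = (p i j + p j i) / n`. -/
def edgeWeight {n : ℕ} (P : Matrix (Fin n) (Fin n) ℝ) : Sym2 (Fin n) → ℝ :=
  Sym2.lift ⟨fun i j => (P i j + P j i) / n, fun i j => by show (P i j + P j i) / n = (P j i + P i j) / n; rw [add_comm (P i j)]⟩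

/-- The weighted Laplacian of the graph on `Fin n` with edge set `Es`,
with weight `edgeWeight P e` on the edge `e`. -/
def lap {n : ℕ} (P : Matrix (Fin n) (Fin n) ℝ) (Es : Finset (Sym2 (Fin n))) :
    Matrix (Fin n) (Fin n) ℝ :=
  ∑ e ∈ Es, edgeWeight P e • dmat e

/-- The unit-weight (standard) Laplacian of the graph with edge set `Es`. -/
def lapStd {n : ℕ} (Es : Finset (Sym2 (Fin n))) : Matrix (Fin n) (Fin n) ℝ :=
  ∑ e ∈ Es, dmat e

/-- Largest (real) eigenvalue of a matrix. For a real symmetric matrix this is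
`λ_max`. -/
def lamMax {n : ℕ} (M : Matrix (Fin n) (Fin n) ℝ) : ℝ :=
  sSup {t : ℝ | ∃ v : Fin n → ℝ, v ≠ 0 ∧ M *ᵥ v = t • v}

/-- Smallest (real) eigenvalue of a matrix. -/
def lamMin {n : ℕ} (M : Matrix (Fin n) (Fin n) ℝ) : ℝ :=
  sInf {t : ℝ | ∃ v : Fin n → ℝ, v ≠ 0 ∧ M *ᵥ v = t • v}

/-- Second smallest eigenvalue of a (connected-graph) Laplacian: the smallest
eigenvalue attained by an eigenvector orthogonal to the all-ones vector. -/
def lam2 {n : ℕ} (M : Matrix (Fin n) (Fin n) ℝ) : ℝ :=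
  sInf {t : ℝ | ∃ v : Fin n → ℝ, v ≠ 0 ∧ (∑ i, v i = 0) ∧ M *ᵥ v = t • v}

/-- `P` is row-stochastic. -/
def RowStochastic {n : ℕ} (P : Matrix (Fin n) (Fin n) ℝ) : Prop :=
  (∀ i j, 0 ≤ P i j) ∧ ∀ i, ∑ j, P i j = 1

/-- `P` complies with the graph with edge set `E`. -/
def Complies {n : ℕ} (P : Matrix (Fin n) (Fin n) ℝ) (E : Finset (Sym2 (Fin n))) : Prop :=
  ∀ i j : Fin n, i ≠ j → 0 < P i j → s(i, j) ∈ E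

/-- The simple graph on `Fin n` with edge set `E`. -/
def graphOf {n : ℕ} (E : Finset (Sym2 (Fin n))) : SimpleGraph (Fin n) :=
  SimpleGraph.fromEdgeSet (↑E)

/-- `diam x = max_i x i - min_i x i`  (the quantity `𝔛` of the paper). -/
def diam {n : ℕ} (x : Fin n → ℝ) : ℝ := (⨆ i, x i) - ⨅ i, x i

/-- Selection alphabet `E ∪ {∗}` : an unordered node pair, or no selection. -/
abbrev Sel (n : ℕ) := Option (Sym2 (Fin n))

instance (n : ℕ) : MeasurableSpace (Sel n) := ⊤

/-- The update matrix triggered by a selection. -/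
def Wsel {n : ℕ} (α β : ℝ) (Epst Eneg : Finset (Sym2 (Fin n))) :
    Sel n → Matrix (Fin n) (Fin n) ℝ
  | none => 1
  | some e => if e ∈ Epst then Wpos α e else if e ∈ Eneg then Wneg β e else 1

/-- The belief process `x(k)` driven by the selection sequence `ω`. -/
def xproc {n : ℕ} (α β : ℝ) (Epst Eneg : Finset (Sym2 (Fin n))) (x0 : Fin n → ℝ)
    (ω : ℕ → Sel n) : ℕ → Fin n → ℝ
  | 0 => x0
  | k + 1 => Wsel α β Epst Eneg (ω k) *ᵥ xproc α β Epst Eneg x0 ω k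

/-- The matrix product `W(k) W(k-1) ⋯ W(0)`. -/
def Wprod {n : ℕ} (α β : ℝ) (Epst Eneg : Finset (Sym2 (Fin n))) (ω : ℕ → Sel n) :
    ℕ → Matrix (Fin n) (Fin n) ℝ
  | 0 => Wsel α β Epst Eneg (ω 0)
  | k + 1 => Wsel α β Epst Eneg (ω (k + 1)) * Wprod α β Epst Eneg ω k

/-- The one-step selection distribution `μ` on `E ∪ {∗}`. -/
def seldist {n : ℕ} (P : Matrix (Fin n) (Fin n) ℝ) (E : Finset (Sym2 (Fin n))) :
    Sel n → ℝ≥0∞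
  | none => ENNReal.ofReal (1 - ∑ e ∈ E, edgeWeight P e)
  | some e => if e ∈ E then ENNReal.ofReal (edgeWeight P e) else 0

/-- `ℙ` is the infinite product of `seldist P E`: the coordinates are i.i.d.
with per-coordinate distribution `seldist P E` (characterized on cylinders). -/
def IsIIDSel {n : ℕ} (ℙ : Measure (ℕ → Sel n)) (P : Matrix (Fin n) (Fin n) ℝ)
    (E : Finset (Sym2 (Fin n))) : Prop :=
  ∀ (K : Finset ℕ) (v : ℕ → Sel n),
    ℙ {ω | ∀ k ∈ K, ω k = v k} = ∏ k ∈ K, seldist P E (v k)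

/-- Selection alphabet for the asymmetric constrained model:
an ordered node pair (or `∗`), together with a tag in `{1,2,3}`. -/
abbrev Sel2 (n : ℕ) := Option (Fin n × Fin n) × Fin 3

instance (n : ℕ) : MeasurableSpace (Sel2 n) := ⊤

/-- weights `a, b, c` on the tags. -/
def wabc (a b c : ℝ) : Fin 3 → ℝ := ![a, b, c]

/-- Per-step distribution for the asymmetric constrained model: the pair
`({i,j}, t)` (represented by its ordered representative with `i < j`) has mass
`(wabc a b c t) · μ({i,j})`, and `(∗, t)` has mass `(wabc a b c t) · μ(∗)`. -/
def seldist2 {n : ℕ} (P : Matrix (Fin n) (Fin n) ℝ) (E : Finset (Sym2 (Fin n)))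
    (a b c : ℝ) : Sel2 n → ℝ≥0∞
  | (none, t) => ENNReal.ofReal (wabc a b c t) * ENNReal.ofReal (1 - ∑ e ∈ E, edgeWeight P e)
  | (some (i, j), t) =>
      if i < j ∧ s(i, j) ∈ E then
        ENNReal.ofReal (wabc a b c t) * ENNReal.ofReal (edgeWeight P s(i, j))
      else 0

/-- `ℙ` is the infinite product of `seldist2 P E a b c`. -/
def IsIIDSel2 {n : ℕ} (ℙ : Measure (ℕ → Sel2 n)) (P : Matrix (Fin n) (Fin n) ℝ)
    (E : Finset (Sym2 (Fin n))) (a b c : ℝ) : Prop :=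
  ∀ (K : Finset ℕ) (v : ℕ → Sel2 n),
    ℙ {ω | ∀ k ∈ K, ω k = v k} = ∏ k ∈ K, seldist2 P E a b c (v k)

/-- Projection onto `[-A, A]`. -/
def projA (A z : ℝ) : ℝ := max (-A) (min A z)

/-- `θ(e) = α` on positive edges, `-β` on negative edges. -/
def theta {n : ℕ} (α β : ℝ) (Epst Eneg : Finset (Sym2 (Fin n))) (e : Sym2 (Fin n)) : ℝ :=
  if e ∈ Epst then α else if e ∈ Eneg then -β else 0

/-- One step of the asymmetric constrained update. -/
def cstep {n : ℕ} (α β A : ℝ) (Epst Eneg : Finset (Sym2 (Fin n))) :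
    Sel2 n → (Fin n → ℝ) → (Fin n → ℝ)
  | (none, _), x => x
  | (some (i, j), t), x =>
      if t = 0 then
        Function.update x i
          (projA A ((1 - theta α β Epst Eneg s(i, j)) * x i + theta α β Epst Eneg s(i, j) * x j))
      else if t = 1 then
        Function.update x j
          (projA A ((1 - theta α β Epst Eneg s(i, j)) * x j + theta α β Epst Eneg s(i, j) * x i))
      else
        Function.update
          (Function.update x i
            (projA A ((1 - theta α β Epst Eneg s(i, j)) * x i + theta α β Epst Eneg s(i, j) * x j)))
          j
          (projA A ((1 - theta α β Epst Eneg s(i, j)) * x j + theta α β Epst Eneg s(i, j) * x i))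

/-- The constrained asymmetric belief process. -/
def cproc {n : ℕ} (α β A : ℝ) (Epst Eneg : Finset (Sym2 (Fin n))) (x0 : Fin n → ℝ)
    (ω : ℕ → Sel2 n) : ℕ → Fin n → ℝ
  | 0 => x0
  | k + 1 => cstep α β A Epst Eneg (ω k) (cproc α β A Epst Eneg x0 ω k)

/-- The squared opinion difference across an unordered pair. -/
def edgeSq {n : ℕ} (x : Fin n → ℝ) : Sym2 (Fin n) → ℝ :=
  Sym2.lift ⟨fun i j => (x i - x j) ^ 2, fun i j => by ring⟩

/-- The quadratic disagreement `n ∑ xᵢ² - (∑ xᵢ)²`. -/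
def spread {n : ℕ} (x : Fin n → ℝ) : ℝ := n * ∑ i, x i ^ 2 - (∑ i, x i) ^ 2

lemma edgeSq_mk {n : ℕ} (x : Fin n → ℝ) (a b : Fin n) : edgeSq x s(a, b) = (x a - x b) ^ 2 := rfl

lemma edgeSq_nonneg {n : ℕ} (x : Fin n → ℝ) (e : Sym2 (Fin n)) : 0 ≤ edgeSq x e := by
  induction e with | _ a b => exact sq_nonneg _

lemma two_mul_spread {n : ℕ} (x : Fin n → ℝ) :
    2 * spread x = ∑ a, ∑ b, (x a - x b) ^ 2 := by
  have h : ∀ a b, (x a - x b) ^ 2 = x a ^ 2 + x b ^ 2 - 2 * (x a * x b) := fun a b => by ring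
  simp only [h, Finset.sum_sub_distrib, Finset.sum_add_distrib, ← Finset.mul_sum,
    Finset.sum_const, ← Finset.sum_mul, Finset.card_univ, Fintype.card_fin, nsmul_eq_mul, spread]
  ring

lemma spread_nonneg {n : ℕ} (x : Fin n → ℝ) : 0 ≤ spread x := by
  have := two_mul_spread x
  have : 0 ≤ ∑ a, ∑ b, (x a - x b) ^ 2 :=
    Finset.sum_nonneg fun a _ => Finset.sum_nonneg fun b _ => sq_nonneg _
  linarith

lemma sum_mul_esub {n : ℕ} (x : Fin n → ℝ) (a b : Fin n) :
    ∑ k, x k * esub a b k = x a - x b := by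
  simp [esub, mul_sub]

lemma sum_esub {n : ℕ} (a b : Fin n) : ∑ k, esub a b k = 0 := by
  simp [esub]

lemma dmat_mulVec {n : ℕ} (x : Fin n → ℝ) (a b : Fin n) :
    dmat s(a, b) *ᵥ x = (x a - x b) • esub a b := by
  ext k
  rw [← sum_mul_esub x a b]
  simp only [dmat, Sym2.lift_mk, dmatAux, mulVec, dotProduct, vecMulVec_apply, Pi.smul_apply,
    smul_eq_mul, Finset.sum_mul]
  exact Finset.sum_congr rfl fun i _ => by ring

lemma sum_sub_smul_dmat {n : ℕ} (θ : ℝ) (x : Fin n → ℝ) (e : Sym2 (Fin n)) :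
    ∑ i, (x - θ • (dmat e *ᵥ x)) i = ∑ i, x i := by
  induction e with | _ a b =>
  simp [dmat_mulVec, Finset.sum_sub_distrib, ← Finset.mul_sum, sum_esub]

lemma spread_sub_smul_dmat {n : ℕ} (θ : ℝ) (x : Fin n → ℝ) (e : Sym2 (Fin n)) :
    spread (x - θ • (dmat e *ᵥ x)) = spread x - 2 * n * (θ * (1 - θ)) * edgeSq x e := by
  rw [spread, sum_sub_smul_dmat, spread]
  induction e with | _ a b =>
  have h1 : ∀ k, (x - θ • (dmat s(a, b) *ᵥ x)) k ^ 2 = x k ^ 2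
      - 2 * θ * (x a - x b) * (x k * esub a b k)
      + (θ * (x a - x b)) ^ 2 * (esub a b k * esub a b k) := fun k => by
    simp only [dmat_mulVec, Pi.sub_apply, Pi.smul_apply, smul_eq_mul]; ring
  have h2 : (x a - x b) ^ 2 * (esub a b a - esub a b b) = (x a - x b) ^ 2 * 2 := by
    by_cases h : a = b
    · simp [h]
    · simp [esub, h, Ne.symm h]; norm_num
  simp only [h1, Finset.sum_add_distrib, Finset.sum_sub_distrib, ← Finset.mul_sum, sum_mul_esub,
    edgeSq_mk]
  linear_combination n * θ ^ 2 * h2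

lemma edgeSq_le_spread {n : ℕ} (x : Fin n → ℝ) (e : Sym2 (Fin n)) :
    n * edgeSq x e ≤ 2 * spread x := by
  have h := spread_nonneg (x - (1 / 2 : ℝ) • (dmat e *ᵥ x))
  rw [spread_sub_smul_dmat] at h
  linarith

lemma Wpos_mulVec {n : ℕ} (α : ℝ) (e : Sym2 (Fin n)) (x : Fin n → ℝ) :
    Wpos α e *ᵥ x = x - α • (dmat e *ᵥ x) := by
  simp [Wpos, sub_mulVec, smul_mulVec]

lemma Wsel_some_mulVec {n : ℕ} (α β : ℝ) (Epst Eneg : Finset (Sym2 (Fin n)))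
    (e : Sym2 (Fin n)) (x : Fin n → ℝ) :
    Wsel α β Epst Eneg (some e) *ᵥ x = x - theta α β Epst Eneg e • (dmat e *ᵥ x) := by
  simp only [Wsel, theta]
  split_ifs <;> simp [Wpos, Wneg, sub_mulVec, add_mulVec, smul_mulVec]

lemma spread_Wsel_some {n : ℕ} (α β : ℝ) (Epst Eneg : Finset (Sym2 (Fin n)))
    (e : Sym2 (Fin n)) (x : Fin n → ℝ) :
    spread (Wsel α β Epst Eneg (some e) *ᵥ x) = spread x -
      2 * n * (theta α β Epst Eneg e * (1 - theta α β Epst Eneg e)) * edgeSq x e := by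
  rw [Wsel_some_mulVec, spread_sub_smul_dmat]

lemma sum_Wsel_mulVec {n : ℕ} (α β : ℝ) (Epst Eneg : Finset (Sym2 (Fin n)))
    (a : Sel n) (x : Fin n → ℝ) :
    ∑ i, (Wsel α β Epst Eneg a *ᵥ x) i = ∑ i, x i := by
  cases a with
  | none => simp [Wsel]
  | some e => rw [Wsel_some_mulVec, sum_sub_smul_dmat]

/-- A single update shrinks the disagreement by at most the factor `(1 - 2α)²`. -/
lemma le_spread_Wsel {n : ℕ} {α β : ℝ} (hα0 : 0 < α) (hα1 : α < 1) (hβ : 0 ≤ β)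
    (Epst Eneg : Finset (Sym2 (Fin n))) (a : Sel n) (x : Fin n → ℝ) :
    (1 - 2 * α) ^ 2 * spread x ≤ spread (Wsel α β Epst Eneg a *ᵥ x) := by
  have h0 := spread_nonneg x
  have h4 : 0 ≤ α * (1 - α) := mul_nonneg hα0.le (by linarith)
  cases a with
  | none =>
    simp only [Wsel, one_mulVec]
    nlinarith [mul_nonneg h4 h0]
  | some e =>
    rw [spread_Wsel_some]
    have h1 := edgeSq_le_spread x e
    have h2 := edgeSq_nonneg x e
    have h3 := mul_nonneg h4 h0
    have h5 : 0 ≤ (n : ℝ) * edgeSq x e := by positivity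
    unfold theta
    split_ifs
    · nlinarith [mul_le_mul_of_nonneg_left h1 h4]
    · nlinarith [mul_nonneg (mul_nonneg hβ (by linarith : 0 ≤ 1 + β)) h5]
    · nlinarith

/-- A Poincaré inequality for connected graphs. -/
lemma exists_spread_le {n : ℕ} {E : Finset (Sym2 (Fin n))} (hE : (graphOf E).Connected) :
    ∃ κ : ℝ, 0 < κ ∧ ∀ x : Fin n → ℝ, spread x ≤ κ * ∑ e ∈ E, edgeSq x e := by
  have hS : ∀ x : Fin n → ℝ, 0 ≤ ∑ e ∈ E, edgeSq x e := fun x =>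
    Finset.sum_nonneg fun e _ => edgeSq_nonneg x e
  have key : ∀ a b : Fin n, ∃ K : ℝ, 0 ≤ K ∧
      ∀ x : Fin n → ℝ, (x a - x b) ^ 2 ≤ K * ∑ e ∈ E, edgeSq x e := by
    intro a b
    have hr := (SimpleGraph.reachable_iff_reflTransGen a b).1 (hE.preconnected a b)
    induction hr with
    | refl => exact ⟨0, le_rfl, fun x => by simp⟩
    | @tail b c _ hbc ih =>
      obtain ⟨K, hK, h⟩ := ih
      refine ⟨2 * K + 2, by linarith, fun x => ?_⟩
      have hmem : s(b, c) ∈ E := by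
        simpa using ((SimpleGraph.fromEdgeSet_adj _).1 hbc).1
      have h1 : edgeSq x s(b, c) ≤ ∑ e ∈ E, edgeSq x e :=
        Finset.single_le_sum (f := edgeSq x) (fun e _ => edgeSq_nonneg x e) hmem
      rw [edgeSq_mk] at h1
      nlinarith [h x, sq_nonneg ((x a - x b) - (x b - x c))]
  choose K hK0 hK using key
  refine ⟨1 + ∑ a, ∑ b, K a b, ?_, fun x => ?_⟩
  · have : 0 ≤ ∑ a, ∑ b, K a b :=
      Finset.sum_nonneg fun a _ => Finset.sum_nonneg fun b _ => hK0 a b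
    linarith
  · have h1 : ∑ a, ∑ b, (x a - x b) ^ 2 ≤ (∑ a, ∑ b, K a b) * ∑ e ∈ E, edgeSq x e := by
      simp only [Finset.sum_mul]
      exact Finset.sum_le_sum fun a _ => Finset.sum_le_sum fun b _ => by
        simpa only [Finset.sum_mul, Finset.mul_sum] using hK a b x
    rw [← two_mul_spread] at h1
    nlinarith [hS x, spread_nonneg x]

instance (n : ℕ) : MeasurableSingletonClass (Sel n) := ⟨fun _ => trivial⟩

/-- The averaging operator of the Markov chain which applies the matrix `W a` with weight `m a`. -/
def stepAvg {n : ℕ} {A : Type*} [Fintype A] (m : A → ℝ) (W : A → Matrix (Fin n) (Fin n) ℝ)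
    (φ : (Fin n → ℝ) → ℝ) (x : Fin n → ℝ) : ℝ :=
  ∑ a, m a * φ (W a *ᵥ x)

lemma stepAvg_nonneg {n : ℕ} {A : Type*} [Fintype A] {m : A → ℝ} (hm : ∀ a, 0 ≤ m a)
    (W : A → Matrix (Fin n) (Fin n) ℝ) {φ : (Fin n → ℝ) → ℝ} (hφ : ∀ x, 0 ≤ φ x)
    (x : Fin n → ℝ) : 0 ≤ stepAvg m W φ x :=
  Finset.sum_nonneg fun a _ => mul_nonneg (hm a) (hφ _)

lemma iterate_stepAvg_nonneg {n : ℕ} {A : Type*} [Fintype A] {m : A → ℝ} (hm : ∀ a, 0 ≤ m a)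
    (W : A → Matrix (Fin n) (Fin n) ℝ) {φ : (Fin n → ℝ) → ℝ} (hφ : ∀ x, 0 ≤ φ x) (k : ℕ) :
    ∀ x, 0 ≤ (stepAvg m W)^[k] φ x := by
  induction k with
  | zero => simpa using hφ
  | succ k ih =>
    rw [Function.iterate_succ_apply']
    exact stepAvg_nonneg hm W ih

/-- Iterates of the averaging operator preserve inequalities on an invariant set. -/
lemma iterate_stepAvg_le {n : ℕ} {A : Type*} [Fintype A] {m : A → ℝ} (hm : ∀ a, 0 ≤ m a)
    {W : A → Matrix (Fin n) (Fin n) ℝ} {N : Set (Fin n → ℝ)}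
    (hN : ∀ a, ∀ x ∈ N, W a *ᵥ x ∈ N) {φ ψ : (Fin n → ℝ) → ℝ} {c : ℝ}
    (h : ∀ x ∈ N, φ x ≤ c * ψ x) (k : ℕ) :
    ∀ x ∈ N, (stepAvg m W)^[k] φ x ≤ c * (stepAvg m W)^[k] ψ x := by
  induction k with
  | zero => simpa using h
  | succ k ih =>
    intro x hx
    rw [Function.iterate_succ_apply', Function.iterate_succ_apply', stepAvg, stepAvg,
      Finset.mul_sum]
    refine Finset.sum_le_sum fun a _ => ?_
    nlinarith [mul_le_mul_of_nonneg_left (ih _ (hN a x hx)) (hm a)]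

/-- A one-step contraction iterates geometrically. -/
lemma iterate_stepAvg_le_pow {n : ℕ} {A : Type*} [Fintype A] {m : A → ℝ} (hm : ∀ a, 0 ≤ m a)
    {W : A → Matrix (Fin n) (Fin n) ℝ} {N : Set (Fin n → ℝ)}
    (hN : ∀ a, ∀ x ∈ N, W a *ᵥ x ∈ N) {φ : (Fin n → ℝ) → ℝ} {c : ℝ} (hc : 0 ≤ c) (q : ℕ)
    (h : ∀ x ∈ N, (stepAvg m W)^[q] φ x ≤ c * φ x) (k : ℕ) :
    ∀ x ∈ N, (stepAvg m W)^[q * k] φ x ≤ c ^ k * φ x := by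
  induction k with
  | zero => simp
  | succ k ih =>
    intro x hx
    rw [Nat.mul_succ, Function.iterate_add_apply]
    calc _ ≤ c * (stepAvg m W)^[q * k] φ x := iterate_stepAvg_le hm hN h _ x hx
      _ ≤ c * (c ^ k * φ x) := mul_le_mul_of_nonneg_left (ih x hx) hc
      _ = _ := by ring

/-- A finite word of selections, continued by idle steps. -/
def extendWord {n k : ℕ} (w : Fin k → Sel n) : ℕ → Sel n :=
  fun i => if h : i < k then w ⟨i, h⟩ else none

lemma xproc_congr {n : ℕ} (α β : ℝ) (Epst Eneg : Finset (Sym2 (Fin n))) (x0 : Fin n → ℝ)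
    {ω ω' : ℕ → Sel n} {k : ℕ} (h : ∀ i < k, ω i = ω' i) :
    xproc α β Epst Eneg x0 ω k = xproc α β Epst Eneg x0 ω' k := by
  induction k with
  | zero => rfl
  | succ k ih => rw [xproc, xproc, ih fun i hi => h i (by omega), h k (by omega)]

lemma sum_words_xproc {n : ℕ} (α β : ℝ) (Epst Eneg : Finset (Sym2 (Fin n))) (x0 : Fin n → ℝ)
    (m : Sel n → ℝ) (k : ℕ) : ∀ φ : (Fin n → ℝ) → ℝ,
    ∑ w : Fin k → Sel n, (∏ i, m (w i)) * φ (xproc α β Epst Eneg x0 (extendWord w) k) =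
      (stepAvg m (Wsel α β Epst Eneg))^[k] φ x0 := by
  induction k with
  | zero => intro φ; simp [xproc]
  | succ k ih =>
    intro φ
    rw [Function.iterate_succ_apply, ← ih, ← (Fin.snocEquiv fun _ => Sel n).sum_comp,
      Fintype.sum_prod_type_right]
    refine Finset.sum_congr rfl fun w _ => ?_
    rw [stepAvg, Finset.mul_sum]
    refine Finset.sum_congr rfl fun a _ => ?_
    have h1 : xproc α β Epst Eneg x0 (extendWord (Fin.snoc w a : Fin (k + 1) → Sel n)) k =
        xproc α β Epst Eneg x0 (extendWord w) k :=
      xproc_congr _ _ _ _ _ fun i hi => by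
        simp [extendWord, hi, Nat.lt_succ_of_lt hi, Fin.snoc]
    have h2 : extendWord (Fin.snoc w a : Fin (k + 1) → Sel n) k = a := by
      simp [extendWord, Fin.snoc]
    have h3 : (Fin.snocEquiv fun _ => Sel n) (a, w) = (Fin.snoc w a : Fin (k + 1) → Sel n) := rfl
    rw [h3, xproc, h1, h2, Fin.prod_univ_castSucc]
    simp only [Fin.snoc_castSucc, Fin.snoc_last]
    ring

lemma xproc_eq_word {n : ℕ} (α β : ℝ) (Epst Eneg : Finset (Sym2 (Fin n))) (x0 : Fin n → ℝ)
    (k : ℕ) (ω : ℕ → Sel n) :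
    xproc α β Epst Eneg x0 ω k =
      xproc α β Epst Eneg x0 (extendWord fun i : Fin k => ω i) k :=
  xproc_congr _ _ _ _ _ fun i hi => by simp [extendWord, hi]

lemma measurable_restrict_fin {n : ℕ} (k : ℕ) :
    Measurable fun (ω : ℕ → Sel n) (i : Fin k) => ω i :=
  measurable_pi_lambda _ fun _ => measurable_pi_apply _

lemma measurable_comp_xproc {n : ℕ} (α β : ℝ) (Epst Eneg : Finset (Sym2 (Fin n)))
    (x0 : Fin n → ℝ) (φ : (Fin n → ℝ) → ℝ) (k : ℕ) :
    Measurable fun ω => φ (xproc α β Epst Eneg x0 ω k) := by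
  rw [funext fun ω => congrArg φ (xproc_eq_word α β Epst Eneg x0 k ω)]
  exact (measurable_of_finite fun w : Fin k → Sel n =>
    φ (xproc α β Epst Eneg x0 (extendWord w) k)).comp (measurable_restrict_fin k)

lemma seldist_ne_top {n : ℕ} (P : Matrix (Fin n) (Fin n) ℝ) (E : Finset (Sym2 (Fin n)))
    (a : Sel n) : seldist P E a ≠ ⊤ := by
  cases a with
  | none => simp [seldist]
  | some e => simp only [seldist]; split_ifs <;> simp

lemma measure_restrict_fin {n : ℕ} {ℙ : Measure (ℕ → Sel n)} {P : Matrix (Fin n) (Fin n) ℝ}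
    {E : Finset (Sym2 (Fin n))} (hiid : IsIIDSel ℙ P E) {k : ℕ} (w : Fin k → Sel n) :
    ℙ ((fun ω (i : Fin k) => ω i) ⁻¹' {w}) = ENNReal.ofReal (∏ i, (seldist P E (w i)).toReal) := by
  have h := hiid (Finset.range k) (extendWord w)
  rw [ENNReal.ofReal_prod_of_nonneg fun _ _ => ENNReal.toReal_nonneg]
  simp only [ENNReal.ofReal_toReal (seldist_ne_top P E _)]
  rw [Finset.prod_range] at h
  convert h using 2
  · ext ω
    simp only [Set.mem_preimage, Set.mem_singleton_iff, funext_iff, Set.mem_ofPred_eq,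
      Finset.mem_range]
    exact ⟨fun h i hi => by simpa [extendWord, hi] using h ⟨i, hi⟩,
      fun h i => by simpa [extendWord] using h i i.2⟩
  · simp [extendWord]

/-- Expectations along the process are iterates of the averaging operator. -/
lemma lintegral_comp_xproc {n : ℕ} (α β : ℝ) {Epst Eneg E : Finset (Sym2 (Fin n))}
    {ℙ : Measure (ℕ → Sel n)} {P : Matrix (Fin n) (Fin n) ℝ} (hiid : IsIIDSel ℙ P E)
    (x0 : Fin n → ℝ) {φ : (Fin n → ℝ) → ℝ} (hφ : ∀ x, 0 ≤ φ x) (k : ℕ) :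
    ∫⁻ ω, ENNReal.ofReal (φ (xproc α β Epst Eneg x0 ω k)) ∂ℙ = ENNReal.ofReal
      ((stepAvg (fun a => (seldist P E a).toReal) (Wsel α β Epst Eneg))^[k] φ x0) := by
  rw [funext fun ω => congrArg (fun y => ENNReal.ofReal (φ y))
    (xproc_eq_word α β Epst Eneg x0 k ω), ← lintegral_map (f := fun w : Fin k → Sel n =>
    ENNReal.ofReal (φ (xproc α β Epst Eneg x0 (extendWord w) k))) (measurable_of_finite _)
    (measurable_restrict_fin k), lintegral_fintype, ← sum_words_xproc, ENNReal.ofReal_sum_of_nonneg]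
  · refine Finset.sum_congr rfl fun w _ => ?_
    rw [Measure.map_apply (measurable_restrict_fin k) (measurableSet_singleton w),
      measure_restrict_fin hiid, ENNReal.ofReal_mul, mul_comm]
    exact Finset.prod_nonneg fun _ _ => ENNReal.toReal_nonneg
  · exact fun w _ => mul_nonneg (Finset.prod_nonneg fun _ _ => ENNReal.toReal_nonneg) (hφ _)

lemma sum_seldist {n : ℕ} {ℙ : Measure (ℕ → Sel n)} [IsProbabilityMeasure ℙ]
    {P : Matrix (Fin n) (Fin n) ℝ} {E : Finset (Sym2 (Fin n))} (hiid : IsIIDSel ℙ P E) :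
    ∑ a, (seldist P E a).toReal = 1 := by
  have h := lintegral_comp_xproc 0 0 (Epst := ∅) (Eneg := ∅) hiid 0 (φ := fun _ => 1)
    (fun _ => zero_le_one) 1
  have h1 : (1 : ℝ≥0∞) = ENNReal.ofReal (∑ a, (seldist P E a).toReal) := by
    simpa [stepAvg] using h
  exact ENNReal.ofReal_eq_one.1 h1.symm

/-- If the expectations of a nonnegative function along the process are summable, then the
function almost surely tends to zero along the process. -/
lemma ae_tendsto_zero_of_summable {n : ℕ} (α β : ℝ) {Epst Eneg E : Finset (Sym2 (Fin n))}
    {ℙ : Measure (ℕ → Sel n)} {P : Matrix (Fin n) (Fin n) ℝ} (hiid : IsIIDSel ℙ P E)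
    (x0 : Fin n → ℝ) {φ : (Fin n → ℝ) → ℝ} (hφ : ∀ x, 0 ≤ φ x)
    (hs : Summable fun k =>
      (stepAvg (fun a => (seldist P E a).toReal) (Wsel α β Epst Eneg))^[k] φ x0) :
    ∀ᵐ ω ∂ℙ, Tendsto (fun k => φ (xproc α β Epst Eneg x0 ω k)) atTop (nhds 0) := by
  have hmeas : ∀ k, Measurable fun ω => ENNReal.ofReal (φ (xproc α β Epst Eneg x0 ω k)) :=
    fun k => (measurable_comp_xproc α β Epst Eneg x0 φ k).ennreal_ofReal
  have hfin : ∫⁻ ω, ∑' k, ENNReal.ofReal (φ (xproc α β Epst Eneg x0 ω k)) ∂ℙ ≠ ⊤ := by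
    rw [lintegral_tsum fun k => (hmeas k).aemeasurable]
    simp_rw [lintegral_comp_xproc α β hiid x0 hφ]
    exact hs.tsum_ofReal_ne_top
  filter_upwards [ae_lt_top (Measurable.tsum hmeas) hfin] with ω hω
  have h := ENNReal.tendsto_atTop_zero_of_tsum_ne_top hω.ne
  have h' := (ENNReal.tendsto_toReal ENNReal.zero_ne_top).comp h
  simpa [Function.comp_def, ENNReal.toReal_ofReal (hφ _)] using h'

lemma exists_pos_le {ι : Type*} (s : Finset ι) (f : ι → ℝ) (hf : ∀ i ∈ s, 0 < f i) :
    ∃ c : ℝ, 0 < c ∧ ∀ i ∈ s, c ≤ f i := by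
  classical
  induction s using Finset.induction_on with
  | empty => exact ⟨1, one_pos, by simp⟩
  | insert a s _ ih =>
    obtain ⟨c, hc, h⟩ := ih fun i hi => hf i (Finset.mem_insert_of_mem hi)
    refine ⟨min c (f a), lt_min hc (hf a (Finset.mem_insert_self _ _)), fun i hi => ?_⟩
    rcases Finset.mem_insert.1 hi with rfl | hi
    · exact min_le_right _ _
    · exact (min_le_left _ _).trans (h i hi)

lemma seldist_some_pos {n : ℕ} (hn : 0 < n) {P : Matrix (Fin n) (Fin n) ℝ}
    {E : Finset (Sym2 (Fin n))} (hpw : ∀ i j : Fin n, s(i, j) ∈ E → 0 < P i j + P j i)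
    {e : Sym2 (Fin n)} (he : e ∈ E) : 0 < (seldist P E (some e)).toReal := by
  have h : 0 < edgeWeight P e := by
    induction e with | _ a b =>
    exact div_pos (hpw a b he) (by exact_mod_cast hn)
  simp only [seldist, if_pos he, ENNReal.toReal_ofReal h.le, h]

/-- For small `β` the expected disagreement contracts at each step. -/
lemma exists_spread_contraction {n : ℕ} (hn : 0 < n) {Epst : Finset (Sym2 (Fin n))}
    (Eneg : Finset (Sym2 (Fin n))) (hpconn : (graphOf Epst).Connected) {α : ℝ} (hα0 : 0 < α)
    (hα1 : α < 1) {m : Sel n → ℝ} (hm : ∀ a, 0 ≤ m a) (hm1 : ∑ a, m a = 1)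
    (hpos : ∀ e ∈ Epst, 0 < m (some e)) :
    ∃ βnat : ℝ, 0 < βnat ∧ ∃ ρ : ℝ, 0 ≤ ρ ∧ ρ < 1 ∧ ∀ β : ℝ, 0 ≤ β → β < βnat →
      ∀ x, stepAvg m (Wsel α β Epst Eneg) spread x ≤ ρ * spread x := by
  obtain ⟨κ, hκ, hpoinc⟩ := exists_spread_le hpconn
  obtain ⟨μ0, hμ0, hμ⟩ := exists_pos_le Epst (fun e => m (some e)) hpos
  have hn' : (0 : ℝ) < n := by exact_mod_cast hn
  have hα : 0 < α * (1 - α) := mul_pos hα0 (by linarith)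
  set δ : ℝ := 2 * n * (α * (1 - α)) * (μ0 / κ) with hδ
  have hδ0 : 0 < δ := by positivity
  refine ⟨min 1 (δ / 16), by positivity, max 0 (1 - δ / 2), le_max_left _ _,
    max_lt one_pos (by linarith), fun β hβ hβ' x => ?_⟩
  have hβ1 : β < 1 := hβ'.trans_le (min_le_left _ _)
  have hβ2 : β < δ / 16 := hβ'.trans_le (min_le_right _ _)
  have hV := spread_nonneg x
  have hstep : ∀ e, spread (Wsel α β Epst Eneg (some e) *ᵥ x) ≤ (1 + 4 * (β * (1 + β))) * spread x
      - (if e ∈ Epst then 2 * n * (α * (1 - α)) * edgeSq x e else 0) := by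
    intro e
    have h1 := edgeSq_le_spread x e
    have h2 : 0 ≤ β * (1 + β) := by positivity
    have h3 := mul_nonneg h2 hV
    rw [spread_Wsel_some]
    unfold theta
    split_ifs
    · nlinarith
    · nlinarith [mul_le_mul_of_nonneg_left h1 h2]
    · nlinarith
  have hsum : stepAvg m (Wsel α β Epst Eneg) spread x ≤ (1 + 4 * (β * (1 + β))) * spread x
      - 2 * n * (α * (1 - α)) * ∑ e ∈ Epst, m (some e) * edgeSq x e := by
    calc stepAvg m (Wsel α β Epst Eneg) spread x
        ≤ m none * ((1 + 4 * (β * (1 + β))) * spread x) + ∑ e, m (some e) *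
          ((1 + 4 * (β * (1 + β))) * spread x
            - (if e ∈ Epst then 2 * n * (α * (1 - α)) * edgeSq x e else 0)) := by
          rw [stepAvg, Fintype.sum_option]
          refine add_le_add (mul_le_mul_of_nonneg_left ?_ (hm _)) (Finset.sum_le_sum fun e _ =>
            mul_le_mul_of_nonneg_left (hstep e) (hm _))
          simp only [Wsel, one_mulVec]
          nlinarith [mul_nonneg (mul_nonneg hβ (by linarith : 0 ≤ 1 + β)) hV]
      _ = _ := by
          rw [Fintype.sum_option] at hm1
          simp only [mul_sub, Finset.sum_sub_distrib, ← Finset.sum_mul, mul_ite, mul_zero,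
            Finset.sum_ite_mem, Finset.univ_inter, Finset.mul_sum]
          rw [← add_sub_assoc, ← add_mul, hm1, one_mul]
          congr 1
          exact Finset.sum_congr rfl fun e _ => by ring
  have hlow : μ0 / κ * spread x ≤ ∑ e ∈ Epst, m (some e) * edgeSq x e := by
    calc μ0 / κ * spread x ≤ μ0 / κ * (κ * ∑ e ∈ Epst, edgeSq x e) :=
          mul_le_mul_of_nonneg_left (hpoinc x) (by positivity)
      _ = ∑ e ∈ Epst, μ0 * edgeSq x e := by rw [← Finset.mul_sum]; field_simp
      _ ≤ _ := Finset.sum_le_sum fun e he =>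
          mul_le_mul_of_nonneg_right (hμ e he) (edgeSq_nonneg x e)
  have hlow' : δ * spread x ≤ 2 * n * (α * (1 - α)) * ∑ e ∈ Epst, m (some e) * edgeSq x e := by
    rw [hδ, mul_assoc]
    exact mul_le_mul_of_nonneg_left hlow (by positivity)
  refine le_trans ?_ (mul_le_mul_of_nonneg_right (le_max_right _ _) hV)
  have : 4 * (β * (1 + β)) ≤ δ / 2 := by nlinarith
  nlinarith [mul_le_mul_of_nonneg_right this hV]

/-- Quadratic form detecting whether short words in the positive updates separate the endpoints
of the pair `f`. -/
def probe {n : ℕ} (α : ℝ) (Epst : Finset (Sym2 (Fin n))) (f : Sym2 (Fin n)) :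
    ℕ → (Fin n → ℝ) → ℝ
  | 0, x => edgeSq x f
  | t + 1, x => probe α Epst f t x + ∑ e ∈ Epst, probe α Epst f t (Wpos α e *ᵥ x)

section Probe

variable {n : ℕ} (α : ℝ) (Epst : Finset (Sym2 (Fin n))) (f : Sym2 (Fin n))

lemma probe_nonneg (t : ℕ) : ∀ x, 0 ≤ probe α Epst f t x := by
  induction t with
  | zero => exact fun x => edgeSq_nonneg x f
  | succ t ih => exact fun x => add_nonneg (ih x) (Finset.sum_nonneg fun e _ => ih _)

lemma probe_mono (x : Fin n → ℝ) : Monotone fun t => probe α Epst f t x :=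
  monotone_nat_of_le_succ fun t =>
    le_add_of_nonneg_right (Finset.sum_nonneg fun _ _ => probe_nonneg α Epst f t _)

lemma probe_smul (t : ℕ) (c : ℝ) :
    ∀ x, probe α Epst f t (c • x) = c ^ 2 * probe α Epst f t x := by
  induction t with
  | zero =>
    intro x
    induction f with | _ a b =>
    simp only [probe, edgeSq_mk, Pi.smul_apply, smul_eq_mul]
    ring
  | succ t ih => intro x; simp only [probe, mulVec_smul, ih, mul_add, Finset.mul_sum]

lemma probe_add_le (t : ℕ) : ∀ x y,
    probe α Epst f t (x + y) ≤ 2 * probe α Epst f t x + 2 * probe α Epst f t y := by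
  induction t with
  | zero =>
    intro x y
    induction f with | _ a b =>
    simp only [probe, edgeSq_mk, Pi.add_apply]
    nlinarith [sq_nonneg ((x a - x b) - (y a - y b))]
  | succ t ih =>
    intro x y
    simp only [probe, mulVec_add]
    have := Finset.sum_le_sum fun e (_ : e ∈ Epst) => ih (Wpos α e *ᵥ x) (Wpos α e *ᵥ y)
    rw [Finset.sum_add_distrib, ← Finset.mul_sum, ← Finset.mul_sum] at this
    linarith [ih x y]

lemma probe_dmat_le (t : ℕ) {e : Sym2 (Fin n)} (he : e ∈ Epst) (x : Fin n → ℝ) :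
    α ^ 2 * probe α Epst f t (dmat e *ᵥ x) ≤ 2 * probe α Epst f (t + 1) x := by
  have h1 : α • (dmat e *ᵥ x) = x + (-1 : ℝ) • (Wpos α e *ᵥ x) := by
    rw [Wpos_mulVec]; module
  rw [← probe_smul, h1]
  have h2 := probe_add_le α Epst f t x ((-1 : ℝ) • (Wpos α e *ᵥ x))
  rw [probe_smul] at h2
  have h3 : probe α Epst f t (Wpos α e *ᵥ x) ≤ ∑ e ∈ Epst, probe α Epst f t (Wpos α e *ᵥ x) :=
    Finset.single_le_sum (f := fun e => probe α Epst f t (Wpos α e *ᵥ x))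
      (fun e _ => probe_nonneg α Epst f t _) he
  simp only [probe]
  linarith

variable {α Epst f}

lemma exists_probe_esub_pos (hα : α ≠ 0) (hconn : (graphOf Epst).Connected)
    (hf : ¬ f.IsDiag) {a b : Fin n} (hab : a ≠ b) :
    ∃ t, 0 < probe α Epst f t (esub a b) := by
  by_contra! hbad
  set Bad : (Fin n → ℝ) → Prop := fun x => ∀ t, probe α Epst f t x ≤ 0 with hBad
  have hsmul : ∀ (c : ℝ) x, Bad x → Bad (c • x) := fun c x hx t => by
    rw [probe_smul]
    nlinarith [hx t, sq_nonneg c]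
  have hadd : ∀ x y, Bad x → Bad y → Bad (x + y) := fun x y hx hy t => by
    linarith [probe_add_le α Epst f t x y, hx t, hy t]
  have hdmat : ∀ e ∈ Epst, ∀ x, Bad x → Bad (dmat e *ᵥ x) := fun e he x hx t => by
    have h1 := probe_dmat_le α Epst f t he x
    have h2 : 0 < α ^ 2 := by positivity
    by_contra! h
    nlinarith [hx (t + 1), mul_pos h2 h]
  have hself : ∀ c : Fin n, Bad (esub c c) := fun c => by
    have : esub c c = (0 : ℝ) • esub a b := by ext; simp [esub]
    rw [this]
    exact hsmul _ _ hbad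
  have hswap : ∀ c d : Fin n, Bad (esub c d) → Bad (esub d c) := fun c d h => by
    have : esub d c = (-1 : ℝ) • esub c d := by ext; simp [esub]
    rw [this]
    exact hsmul _ _ h
  have htrans : ∀ c d k : Fin n, Bad (esub c d) → Bad (esub d k) → Bad (esub c k) :=
    fun c d k h h' => by
      have : esub c k = esub c d + esub d k := by ext; simp [esub]
      rw [this]
      exact hadd _ _ h h'
  have hall : ∀ c, Bad (esub c a) := by
    intro c
    have hr := (SimpleGraph.reachable_iff_reflTransGen a c).1 (hconn.preconnected a c)
    induction hr with
    | refl => exact hself a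
    | @tail c d _ hcd ih =>
      have hadj := (SimpleGraph.fromEdgeSet_adj _).1 hcd
      have hmem : s(c, d) ∈ Epst := by simpa using hadj.1
      have hne : c ≠ d := hadj.2
      by_cases hda : d = a
      · rw [hda]; exact hself a
      by_cases hca : c = a
      · subst hca
        by_cases hdb : d = b
        · rw [hdb]; exact hswap _ _ hbad
        · have h := hdmat _ hmem _ hbad
          rw [dmat_mulVec] at h
          have h1 : esub c b c - esub c b d = 1 := by simp [esub, hab, hda, hdb]
          rw [h1, one_smul] at h
          exact hswap _ _ h
      · have h := hdmat _ hmem _ ih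
        rw [dmat_mulVec] at h
        have h1 : esub c a c - esub c a d = 1 := by simp [esub, hca, hda, hne.symm]
        rw [h1, one_smul] at h
        exact htrans _ _ _ (hswap _ _ h) ih
  induction f with | _ i j =>
  have hij : i ≠ j := by simpa using hf
  have h := htrans _ _ _ (hall i) (hswap _ _ (hall j)) 0
  simp only [probe, edgeSq_mk] at h
  norm_num [esub, hij, hij.symm] at h

/-- Uniform observability of the disagreement through the pair `f`. -/
lemma exists_le_probe (hα : α ≠ 0) (hconn : (graphOf Epst).Connected)
    (hloop : ∀ e ∈ Epst, ¬ e.IsDiag) (hf : ¬ f.IsDiag) :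
    ∃ t, ∃ c : ℝ, 0 < c ∧ ∀ x, c * spread x ≤ probe α Epst f t x := by
  obtain ⟨κ, hκ, hpoinc⟩ := exists_spread_le hconn
  have key : ∀ e, ∃ t, ∃ g : ℝ, 0 < g ∧
      (e ∈ Epst → ∀ x, edgeSq x e ≤ g * probe α Epst f t x) := by
    intro e
    by_cases he : e ∈ Epst
    · induction e with | _ a b =>
      obtain ⟨t, ht⟩ := exists_probe_esub_pos hα hconn hf (by simpa using hloop _ he : a ≠ b)
      have hα2 : 0 < α ^ 2 := by positivity
      refine ⟨t + 1, 2 / (α ^ 2 * probe α Epst f t (esub a b)), by positivity, fun _ x => ?_⟩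
      have h := probe_dmat_le α Epst f t he x
      rw [dmat_mulVec, probe_smul] at h
      rw [edgeSq_mk, div_mul_eq_mul_div, le_div_iff₀ (by positivity)]
      linarith
    · exact ⟨0, 1, one_pos, fun h => absurd h he⟩
  choose t g hg hbd using key
  have hS : 0 ≤ ∑ e ∈ Epst, g e := Finset.sum_nonneg fun e _ => (hg e).le
  refine ⟨Epst.sup t, (κ * (1 + ∑ e ∈ Epst, g e))⁻¹, by positivity, fun x => ?_⟩
  rw [inv_mul_le_iff₀ (by positivity), mul_assoc]
  refine (hpoinc x).trans (mul_le_mul_of_nonneg_left ?_ hκ.le)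
  have hp := probe_nonneg α Epst f (Epst.sup t) x
  calc ∑ e ∈ Epst, edgeSq x e ≤ ∑ e ∈ Epst, g e * probe α Epst f (Epst.sup t) x :=
        Finset.sum_le_sum fun e he => (hbd e he x).trans
          (mul_le_mul_of_nonneg_left (probe_mono α Epst f x (Finset.le_sup he)) (hg e).le)
    _ = (∑ e ∈ Epst, g e) * probe α Epst f (Epst.sup t) x := by rw [Finset.sum_mul]
    _ ≤ _ := by nlinarith

end Probe

lemma stepAvg_le_of_le {n : ℕ} {A : Type*} [Fintype A] {m : A → ℝ} (hm : ∀ a, 0 ≤ m a)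
    (hm1 : ∑ a, m a = 1) {W : A → Matrix (Fin n) (Fin n) ℝ} {φ : (Fin n → ℝ) → ℝ}
    {x : Fin n → ℝ} {B D : ℝ} (hB : ∀ a, φ (W a *ᵥ x) ≤ B) (a₀ : A) (hD : φ (W a₀ *ᵥ x) ≤ D) :
    stepAvg m W φ x ≤ (1 - m a₀) * B + m a₀ * D := by
  have h1 : m a₀ * (B - φ (W a₀ *ᵥ x)) ≤ ∑ a, m a * (B - φ (W a *ᵥ x)) :=
    Finset.single_le_sum (f := fun a => m a * (B - φ (W a *ᵥ x)))
      (fun a _ => mul_nonneg (hm a) (sub_nonneg.2 (hB a))) (Finset.mem_univ a₀)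
  simp only [mul_sub, Finset.sum_sub_distrib, ← Finset.sum_mul, hm1, one_mul] at h1
  rw [stepAvg]
  nlinarith [mul_le_mul_of_nonneg_left hD (hm a₀)]

/-- The negative power of the disagreement used as a Lyapunov function for divergence. -/
def negPow {n : ℕ} (s : ℝ) (x : Fin n → ℝ) : ℝ := spread x ^ (-s)

lemma negPow_nonneg {n : ℕ} (s : ℝ) (x : Fin n → ℝ) : 0 ≤ negPow s x :=
  Real.rpow_nonneg (spread_nonneg x) _

/-- If the disagreement is multiplied by at least `r`, its negative power is multiplied by at
most `(r⁻¹) ^ s`. -/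
lemma negPow_le {n : ℕ} {s r : ℝ} (hs : 0 < s) (hr : 0 < r) {x y : Fin n → ℝ}
    (hx : 0 < spread x) (h : r * spread x ≤ spread y) :
    negPow s y ≤ (r⁻¹) ^ s * negPow s x := by
  have h1 : (r⁻¹) ^ s = r ^ (-s) := by rw [Real.inv_rpow hr.le, Real.rpow_neg hr.le]
  rw [h1, negPow, negPow, ← Real.mul_rpow hr.le hx.le]
  exact Real.rpow_le_rpow_of_nonpos (mul_pos hr hx) h (by linarith)

lemma spread_Wsel_pos {n : ℕ} {α β : ℝ} (hα0 : 0 < α) (hα1 : α < 1) (hαhalf : α ≠ 1 / 2)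
    (hβ : 0 ≤ β) (Epst Eneg : Finset (Sym2 (Fin n))) (a : Sel n) {x : Fin n → ℝ}
    (hx : 0 < spread x) : 0 < spread (Wsel α β Epst Eneg a *ᵥ x) := by
  have h : 1 - 2 * α ≠ 0 := fun h => hαhalf (by linarith)
  exact (by positivity : 0 < (1 - 2 * α) ^ 2 * spread x).trans_le
    (le_spread_Wsel hα0 hα1 hβ Epst Eneg a x)

lemma negPow_Wsel_le {n : ℕ} {α β s : ℝ} (hα0 : 0 < α) (hα1 : α < 1) (hαhalf : α ≠ 1 / 2)
    (hβ : 0 ≤ β) (hs : 0 < s) (Epst Eneg : Finset (Sym2 (Fin n))) (a : Sel n) {x : Fin n → ℝ}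
    (hx : 0 < spread x) :
    negPow s (Wsel α β Epst Eneg a *ᵥ x) ≤ (((1 - 2 * α) ^ 2)⁻¹) ^ s * negPow s x := by
  have h : 1 - 2 * α ≠ 0 := fun h => hαhalf (by linarith)
  exact negPow_le hs (by positivity) hx (le_spread_Wsel hα0 hα1 hβ Epst Eneg a x)

lemma one_le_inv_sq {α : ℝ} (hα0 : 0 < α) (hα1 : α < 1) (hαhalf : α ≠ 1 / 2) :
    1 ≤ ((1 - 2 * α) ^ 2)⁻¹ := by
  have h : 1 - 2 * α ≠ 0 := fun h => hαhalf (by linarith)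
  exact (one_le_inv₀ (by positivity)).2 (by nlinarith)

lemma iterate_negPow_le {n : ℕ} {α β s : ℝ} (hα0 : 0 < α) (hα1 : α < 1) (hαhalf : α ≠ 1 / 2)
    (hβ : 0 ≤ β) (hs : 0 < s) (Epst Eneg : Finset (Sym2 (Fin n))) {m : Sel n → ℝ}
    (hm : ∀ a, 0 ≤ m a) (hm1 : ∑ a, m a = 1) (k : ℕ) {x : Fin n → ℝ} (hx : 0 < spread x) :
    (stepAvg m (Wsel α β Epst Eneg))^[k] (negPow s) x ≤
      ((((1 - 2 * α) ^ 2)⁻¹) ^ s) ^ k * negPow s x := by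
  have hC := one_le_inv_sq hα0 hα1 hαhalf
  have h := iterate_stepAvg_le_pow hm (N := {y | 0 < spread y})
    (fun a y hy => spread_Wsel_pos hα0 hα1 hαhalf hβ Epst Eneg a hy) (φ := negPow s)
    (c := (((1 - 2 * α) ^ 2)⁻¹) ^ s) (by positivity) 1 (fun y hy => by
      have hle := fun a => negPow_Wsel_le hα0 hα1 hαhalf hβ hs Epst Eneg a hy
      have := stepAvg_le_of_le hm hm1 hle none (hle none)
      simp only [Function.iterate_one]
      linarith) k x hx
  rwa [one_mul] at h

/-- If the disagreement is visible through a negative edge after at most `t` positive updates,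
then `t + 1` steps gain a fixed probability of a growth of order `β²`. -/
lemma exists_iterate_negPow_le {n : ℕ} (hn : 0 < n) {Epst Eneg : Finset (Sym2 (Fin n))}
    (hdisj : Disjoint Epst Eneg) {α : ℝ} (hα0 : 0 < α) (hα1 : α < 1) (hαhalf : α ≠ 1 / 2)
    {m : Sel n → ℝ} (hm : ∀ a, 0 ≤ m a) (hm1 : ∑ a, m a = 1)
    (hpos : ∀ e ∈ Epst ∪ Eneg, 0 < m (some e)) {f : Sym2 (Fin n)} (hf : f ∈ Eneg) (t : ℕ) :
    ∀ c : ℝ, 0 < c → ∃ p : ℝ, 0 < p ∧ p ≤ 1 ∧ ∃ K : ℝ, 0 < K ∧ ∀ β : ℝ, 0 < β → ∀ s : ℝ, 0 < s →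
      ∀ x, 0 < spread x → c * spread x ≤ probe α Epst f t x →
        (stepAvg m (Wsel α β Epst Eneg))^[t + 1] (negPow s) x ≤
          (((((1 - 2 * α) ^ 2)⁻¹) ^ s) ^ (t + 1) - p + (K / β ^ 2) ^ s) * negPow s x := by
  have hmle : ∀ a, m a ≤ 1 := fun a => hm1 ▸ Finset.single_le_sum (fun a _ => hm a)
    (Finset.mem_univ a)
  have hC := one_le_inv_sq hα0 hα1 hαhalf
  set C := ((1 - 2 * α) ^ 2)⁻¹ with hCdef
  have hn' : (1 : ℝ) ≤ n := by exact_mod_cast hn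
  induction t with
  | zero =>
    intro c hc
    refine ⟨m (some f), hpos f (Finset.mem_union_right _ hf), hmle _, c⁻¹, by positivity,
      fun β hβ s hs x hx hprobe => ?_⟩
    have hfp : f ∉ Epst := fun h => Finset.disjoint_left.1 hdisj h hf
    have hgrow : β ^ 2 * c * spread x ≤ spread (Wsel α β Epst Eneg (some f) *ᵥ x) := by
      rw [spread_Wsel_some, theta, if_neg hfp, if_pos hf]
      simp only [probe] at hprobe
      have h1 : β ^ 2 * (c * spread x) ≤ β ^ 2 * edgeSq x f :=
        mul_le_mul_of_nonneg_left hprobe (by positivity)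
      have h2 := edgeSq_nonneg x f
      have h3 : 0 ≤ (n - 1 : ℝ) * (β ^ 2 * edgeSq x f) := by
        apply mul_nonneg <;> [linarith; positivity]
      have h4 : 0 ≤ (n : ℝ) * (β * edgeSq x f) := by positivity
      nlinarith [mul_nonneg (sq_nonneg β) h2]
    have hD := negPow_le hs (by positivity) hx hgrow
    have hB := fun a => negPow_Wsel_le hα0 hα1 hαhalf hβ.le hs Epst Eneg a hx
    have h := stepAvg_le_of_le hm hm1 hB (some f) hD
    have hM : 1 ≤ C ^ s := Real.one_le_rpow hC hs.le
    have hη : 0 ≤ (c⁻¹ / β ^ 2) ^ s := by positivity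
    have hrw : (β ^ 2 * c)⁻¹ = c⁻¹ / β ^ 2 := by field_simp
    rw [hrw] at h
    simp only [zero_add, Function.iterate_one, pow_one]
    refine h.trans ?_
    rw [← mul_assoc, ← mul_assoc, ← add_mul]
    refine mul_le_mul_of_nonneg_right ?_ (negPow_nonneg s x)
    nlinarith [mul_nonneg (hm (some f)) (sub_nonneg.2 hM),
      mul_nonneg (sub_nonneg.2 (hmle (some f))) hη]
  | succ t ih =>
    intro c hc
    set c' : ℝ := c / (Epst.card + 1) with hc'
    obtain ⟨p, hp, hp1, K, hK, hIH⟩ := ih c' (by positivity)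
    obtain ⟨μ0, hμ0, hμ⟩ := exists_pos_le Epst (fun e => m (some e))
      fun e he => hpos e (Finset.mem_union_left _ he)
    have hmin0 : 0 < min μ0 1 := lt_min hμ0 one_pos
    have hmin1 : min μ0 1 ≤ 1 := min_le_right _ _
    refine ⟨min μ0 1 * p, by positivity, by nlinarith, C * K, by positivity,
      fun β hβ s hs x hx hprobe => ?_⟩
    have hM : 1 ≤ C ^ s := Real.one_le_rpow hC hs.le
    have hη : 0 ≤ (K / β ^ 2) ^ s := by positivity
    have hV := negPow_nonneg s x
    have hMη : (C * K / β ^ 2) ^ s = C ^ s * (K / β ^ 2) ^ s := by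
      rw [mul_div_assoc, Real.mul_rpow (by positivity) (by positivity)]
    rw [hMη]
    have hinv := fun a (y : Fin n → ℝ) (hy : 0 < spread y) =>
      spread_Wsel_pos hα0 hα1 hαhalf hβ.le Epst Eneg a hy
    by_cases hA : c' * spread x ≤ probe α Epst f t x
    · have h1 := hIH β hβ s hs x hx hA
      have h2 := iterate_stepAvg_le hm (N := {y | 0 < spread y}) hinv
        (φ := stepAvg m (Wsel α β Epst Eneg) (negPow s)) (ψ := negPow s) (c := C ^ s)
        (fun y hy => by
          simpa using iterate_negPow_le hα0 hα1 hαhalf hβ.le hs Epst Eneg hm hm1 1 hy)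
        (t + 1) x hx
      rw [Function.iterate_succ_apply]
      refine h2.trans ((mul_le_mul_of_nonneg_left h1 (by positivity)).trans ?_)
      rw [← mul_assoc]
      refine mul_le_mul_of_nonneg_right ?_ hV
      rw [pow_succ _ (t + 1)]
      nlinarith
    · obtain ⟨e, he, hBe⟩ : ∃ e ∈ Epst, c' * spread x ≤ probe α Epst f t (Wpos α e *ᵥ x) := by
        by_contra! hall
        have h1 : ∑ e ∈ Epst, probe α Epst f t (Wpos α e *ᵥ x) ≤ Epst.card * (c' * spread x) := by
          rw [← nsmul_eq_mul]
          exact Finset.sum_le_card_nsmul _ _ _ fun e he => (hall e he).le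
        have h2 : c * spread x = c' * spread x + Epst.card * (c' * spread x) := by
          rw [hc']; field_simp; ring
        simp only [probe] at hprobe
        linarith
      have hWe : Wsel α β Epst Eneg (some e) = Wpos α e := by simp [Wsel, he]
      rw [← hWe] at hBe
      have hshrink : spread (Wsel α β Epst Eneg (some e) *ᵥ x) ≤ spread x := by
        rw [spread_Wsel_some, theta, if_pos he]
        have h1 := edgeSq_nonneg x e
        have h2 : 0 < 1 - α := by linarith
        have : 0 ≤ 2 * n * (α * (1 - α)) * edgeSq x e := by positivity
        linarith
      have h1 := hIH β hβ s hs _ (hinv (some e) x hx)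
        ((mul_le_mul_of_nonneg_left hshrink (by positivity)).trans hBe)
      have hpow : 1 ≤ (C ^ s) ^ (t + 1) := one_le_pow₀ hM
      have hD := h1.trans (mul_le_mul_of_nonneg_left
        (negPow_Wsel_le hα0 hα1 hαhalf hβ.le hs Epst Eneg (some e) hx) (by linarith))
      have hB : ∀ a, (stepAvg m (Wsel α β Epst Eneg))^[t + 1] (negPow s)
          (Wsel α β Epst Eneg a *ᵥ x) ≤ (C ^ s) ^ (t + 1) * (C ^ s * negPow s x) := fun a =>
        (iterate_negPow_le hα0 hα1 hαhalf hβ.le hs Epst Eneg hm hm1 (t + 1)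
          (hinv a x hx)).trans (mul_le_mul_of_nonneg_left
            (negPow_Wsel_le hα0 hα1 hαhalf hβ.le hs Epst Eneg a hx) (by positivity))
      rw [Function.iterate_succ_apply']
      refine (stepAvg_le_of_le hm hm1 hB (some e) hD).trans ?_
      rw [← hCdef]
      calc (1 - m (some e)) * ((C ^ s) ^ (t + 1) * (C ^ s * negPow s x)) + m (some e) *
            (((C ^ s) ^ (t + 1) - p + (K / β ^ 2) ^ s) * (C ^ s * negPow s x))
          = ((C ^ s) ^ (t + 1 + 1) - m (some e) * (p * C ^ s)
            + m (some e) * (C ^ s * (K / β ^ 2) ^ s)) * negPow s x := by ring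
        _ ≤ _ := by
          refine mul_le_mul_of_nonneg_right ?_ hV
          have h3 : min μ0 1 ≤ m (some e) := (min_le_left _ _).trans (hμ e he)
          have h4 : min μ0 1 * p ≤ m (some e) * (p * C ^ s) :=
            mul_le_mul h3 (le_mul_of_one_le_right hp.le hM) hp.le (hm _)
          have h5 : 0 ≤ C ^ s * (K / β ^ 2) ^ s := by positivity
          nlinarith [mul_nonneg (sub_nonneg.2 (hmle (some e))) h5]

/-- A contraction over blocks of `t + 1` steps makes the iterates summable. -/
lemma summable_iterate_stepAvg {n : ℕ} {A : Type*} [Fintype A] {m : A → ℝ} (hm : ∀ a, 0 ≤ m a)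
    {W : A → Matrix (Fin n) (Fin n) ℝ} {N : Set (Fin n → ℝ)}
    (hN : ∀ a, ∀ x ∈ N, W a *ᵥ x ∈ N) {φ : (Fin n → ℝ) → ℝ} (hφ : ∀ x, 0 ≤ φ x) {t : ℕ}
    {M ρ : ℝ} (hM : 0 ≤ M) (hρ0 : 0 ≤ ρ) (hρ1 : ρ < 1)
    (hshort : ∀ i < t + 1, ∀ x ∈ N, (stepAvg m W)^[i] φ x ≤ M * φ x)
    (hblock : ∀ x ∈ N, (stepAvg m W)^[t + 1] φ x ≤ ρ * φ x) {x : Fin n → ℝ} (hx : x ∈ N) :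
    Summable fun k => (stepAvg m W)^[k] φ x := by
  have hbd : ∀ (q : ℕ) (i : Fin (t + 1)),
      (stepAvg m W)^[q * (t + 1) + i] φ x ≤ M * φ x * ρ ^ q := fun q i => by
    rw [mul_comm q, Function.iterate_add_apply]
    refine (iterate_stepAvg_le hm hN (hshort i i.2) ((t + 1) * q) x hx).trans
      ((mul_le_mul_of_nonneg_left
        (iterate_stepAvg_le_pow hm hN hρ0 (t + 1) hblock q x hx) hM).trans_eq ?_)
    ring
  rw [← (Nat.divModEquiv (t + 1)).symm.summable_iff]
  have hgeo : Summable fun z : ℕ × Fin (t + 1) => ρ ^ z.1 * (1 : ℝ) :=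
    (summable_geometric_of_lt_one hρ0 hρ1).mul_of_nonneg
      (Summable.of_finite) (fun q => pow_nonneg hρ0 q) (fun _ => zero_le_one)
  refine Summable.of_nonneg_of_le
    (fun z => iterate_stepAvg_nonneg hm W hφ _ _) (fun z => ?_) (hgeo.mul_left (M * φ x))
  rw [mul_one]
  exact hbd z.1 z.2

/-- For large `β`, some negative power of the disagreement is summable in expectation. -/
lemma exists_summable_negPow {n : ℕ} (hn : 0 < n) {Epst Eneg : Finset (Sym2 (Fin n))}
    (hdisj : Disjoint Epst Eneg) (hloop : ∀ e ∈ Epst ∪ Eneg, ¬ e.IsDiag)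
    (hneg : Eneg.Nonempty) (hpconn : (graphOf Epst).Connected)
    {α : ℝ} (hα0 : 0 < α) (hα1 : α < 1) (hαhalf : α ≠ 1 / 2)
    {m : Sel n → ℝ} (hm : ∀ a, 0 ≤ m a) (hm1 : ∑ a, m a = 1)
    (hpos : ∀ e ∈ Epst ∪ Eneg, 0 < m (some e)) :
    ∃ s : ℝ, 0 < s ∧ ∃ βsharp : ℝ, 0 < βsharp ∧ ∀ β : ℝ, βsharp < β → ∀ x, 0 < spread x →
      Summable fun k => (stepAvg m (Wsel α β Epst Eneg))^[k] (negPow s) x := by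
  obtain ⟨f, hf⟩ := hneg
  obtain ⟨t, c, hc, hobs⟩ := exists_le_probe (f := f) hα0.ne' hpconn
    (fun e he => hloop e (Finset.mem_union_left _ he)) (hloop f (Finset.mem_union_right _ hf))
  obtain ⟨p, hp, hp1, K, hK, hbound⟩ :=
    exists_iterate_negPow_le hn hdisj hα0 hα1 hαhalf hm hm1 hpos hf t c hc
  have hC := one_le_inv_sq hα0 hα1 hαhalf
  set C := ((1 - 2 * α) ^ 2)⁻¹ with hCdef
  have hC0 : 0 < C := by linarith
  obtain ⟨s, hsC, hs⟩ : ∃ s : ℝ, (C ^ s) ^ (t + 1) < 1 + p / 3 ∧ 0 < s := by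
    have hcont : Continuous fun s : ℝ => (C ^ s) ^ (t + 1) :=
      (Real.continuous_const_rpow hC0.ne').pow _
    have hlim : ∀ᶠ s in nhds (0 : ℝ), (C ^ s) ^ (t + 1) < 1 + p / 3 :=
      hcont.continuousAt.eventually_lt continuousAt_const (by simp; linarith)
    exact ((hlim.filter_mono nhdsWithin_le_nhds).and
      (self_mem_nhdsWithin : Set.Ioi (0 : ℝ) ∈ nhdsWithin 0 (Set.Ioi 0))).exists
  set r : ℝ := (p / 3) ^ s⁻¹ with hr
  have hr0 : 0 < r := by positivity
  refine ⟨s, hs, max 1 (K / r), by positivity, fun β hβ x hx => ?_⟩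
  have hβ1 : 1 < β := (le_max_left _ _).trans_lt hβ
  have hβ0 : 0 < β := by linarith
  have hβK : K / r < β := (le_max_right _ _).trans_lt hβ
  have hsmall : (K / β ^ 2) ^ s ≤ p / 3 := by
    have h1 : K / β ^ 2 ≤ r := by
      rw [div_le_iff₀ (by positivity)]
      rw [div_lt_iff₀ hr0] at hβK
      nlinarith
    calc (K / β ^ 2) ^ s ≤ r ^ s := Real.rpow_le_rpow (by positivity) h1 hs.le
      _ = p / 3 := Real.rpow_inv_rpow (by positivity) hs.ne'
  have hinv := fun a (y : Fin n → ℝ) (hy : 0 < spread y) =>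
    spread_Wsel_pos hα0 hα1 hαhalf hβ0.le Epst Eneg a hy
  have hcontract : ∀ y, 0 < spread y → (stepAvg m (Wsel α β Epst Eneg))^[t + 1] (negPow s) y ≤
      (1 - p / 3) * negPow s y := fun y hy =>
    (hbound β hβ0 s hs y hy (hobs y)).trans
      (mul_le_mul_of_nonneg_right (by linarith) (negPow_nonneg s y))
  have hM : 1 ≤ C ^ s := Real.one_le_rpow hC hs.le
  exact summable_iterate_stepAvg hm hinv (negPow_nonneg s) (M := (C ^ s) ^ (t + 1)) (by positivity)
    (by linarith) (by linarith) (fun i hi y hy =>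
      (iterate_negPow_le hα0 hα1 hαhalf hβ0.le hs Epst Eneg hm hm1 i hy).trans
        (mul_le_mul_of_nonneg_right (pow_le_pow_right₀ hM hi.le) (negPow_nonneg s y)))
    hcontract hx

lemma abs_sub_le_diam {n : ℕ} (x : Fin n → ℝ) (a b : Fin n) : |x a - x b| ≤ diam x := by
  have hu := fun i => le_ciSup (Set.finite_range x).bddAbove i
  have hl := fun i => ciInf_le (Set.finite_range x).bddBelow i
  rw [abs_le, diam]
  constructor <;> linarith [hu a, hu b, hl a, hl b]

lemma exists_diam_eq {n : ℕ} (hn : 0 < n) (x : Fin n → ℝ) : ∃ a b, diam x = x a - x b := by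
  have : Nonempty (Fin n) := ⟨⟨0, hn⟩⟩
  obtain ⟨a, ha⟩ := exists_eq_ciSup_of_finite (f := x)
  obtain ⟨b, hb⟩ := exists_eq_ciInf_of_finite (f := x)
  exact ⟨a, b, by rw [diam, ha, hb]⟩

lemma diam_nonneg {n : ℕ} (hn : 0 < n) (x : Fin n → ℝ) : 0 ≤ diam x :=
  (abs_nonneg _).trans (abs_sub_le_diam x ⟨0, hn⟩ ⟨0, hn⟩)

lemma diam_sq_le_spread {n : ℕ} (hn : 0 < n) (x : Fin n → ℝ) : diam x ^ 2 ≤ 2 * spread x := by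
  obtain ⟨a, b, h⟩ := exists_diam_eq hn x
  have h1 := edgeSq_le_spread x s(a, b)
  have hn' : (1 : ℝ) ≤ n := by exact_mod_cast hn
  rw [edgeSq_mk, ← h] at h1
  nlinarith [sq_nonneg (diam x)]

lemma spread_le_diam_sq {n : ℕ} (x : Fin n → ℝ) : spread x ≤ (n * diam x) ^ 2 := by
  have h : ∑ a, ∑ b, (x a - x b) ^ 2 ≤ ∑ _a : Fin n, ∑ _b : Fin n, diam x ^ 2 :=
    Finset.sum_le_sum fun a _ => Finset.sum_le_sum fun b _ => by
      rw [← sq_abs]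
      exact pow_le_pow_left₀ (abs_nonneg _) (abs_sub_le_diam x a b) 2
  simp only [Finset.sum_const, Finset.card_univ, Fintype.card_fin, nsmul_eq_mul] at h
  nlinarith [two_mul_spread x, spread_nonneg x]

lemma sq_sub_mean_le_spread {n : ℕ} (hn : 0 < n) (x : Fin n → ℝ) (a : Fin n) :
    (x a - (n : ℝ)⁻¹ * ∑ i, x i) ^ 2 ≤ spread x := by
  have hn' : (1 : ℝ) ≤ n := by exact_mod_cast hn
  set c := (n : ℝ)⁻¹ * ∑ i, x i with hc
  have hS : ∑ i, x i = n * c := by rw [hc]; field_simp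
  have h1 : ∑ i, (x i - c) ^ 2 = ∑ i, x i ^ 2 - 2 * c * ∑ i, x i + n * c ^ 2 := by
    have : ∀ i, (x i - c) ^ 2 = x i ^ 2 - 2 * c * x i + c ^ 2 := fun i => by ring
    simp [this, Finset.sum_add_distrib, Finset.sum_sub_distrib, Finset.mul_sum]
  have h2 : (x a - c) ^ 2 ≤ ∑ i, (x i - c) ^ 2 :=
    Finset.single_le_sum (f := fun i => (x i - c) ^ 2) (fun i _ => sq_nonneg _)
      (Finset.mem_univ a)
  have h3 : spread x = n * ∑ i, (x i - c) ^ 2 := by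
    rw [spread, h1, hS]; ring
  rw [h3]
  nlinarith [sq_nonneg (x a - c)]

lemma sum_xproc {n : ℕ} (α β : ℝ) (Epst Eneg : Finset (Sym2 (Fin n))) (x0 : Fin n → ℝ)
    (ω : ℕ → Sel n) (k : ℕ) : ∑ i, xproc α β Epst Eneg x0 ω k i = ∑ i, x0 i := by
  induction k with
  | zero => rfl
  | succ k ih => rw [xproc, sum_Wsel_mulVec, ih]

lemma Wprod_mulVec {n : ℕ} (α β : ℝ) (Epst Eneg : Finset (Sym2 (Fin n))) (x0 : Fin n → ℝ)
    (ω : ℕ → Sel n) (k : ℕ) :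
    Wprod α β Epst Eneg ω k *ᵥ x0 = xproc α β Epst Eneg x0 ω (k + 1) := by
  induction k with
  | zero => rfl
  | succ k ih => rw [Wprod, ← mulVec_mulVec, ih]; rfl

lemma spread_xproc_pos {n : ℕ} {α β : ℝ} (hα0 : 0 < α) (hα1 : α < 1) (hαhalf : α ≠ 1 / 2)
    (hβ : 0 ≤ β) (Epst Eneg : Finset (Sym2 (Fin n))) {x0 : Fin n → ℝ} (hx0 : 0 < spread x0)
    (ω : ℕ → Sel n) (k : ℕ) : 0 < spread (xproc α β Epst Eneg x0 ω k) := by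
  induction k with
  | zero => exact hx0
  | succ k ih => exact spread_Wsel_pos hα0 hα1 hαhalf hβ Epst Eneg _ ih

lemma tendsto_of_sq_le {u v : ℕ → ℝ} (h : ∀ k, u k ^ 2 ≤ v k)
    (hv : Tendsto v atTop (nhds 0)) : Tendsto u atTop (nhds 0) := by
  have h1 : Tendsto (fun k => √(v k)) atTop (nhds 0) := by
    simpa using hv.sqrt
  exact squeeze_zero_norm (fun k => Real.abs_le_sqrt (h k)) h1

lemma prob_eq_one_of_ae {Ω : Type*} [MeasurableSpace Ω] {ℙ : Measure Ω} [IsProbabilityMeasure ℙ]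
    {p : Ω → Prop} (h : ∀ᵐ ω ∂ℙ, p ω) : ℙ {ω | p ω} = 1 := by
  rw [← measure_univ (μ := ℙ)]
  exact measure_congr (eventuallyEq_univ.2 h)

lemma tendsto_Wprod_of_spread {n : ℕ} (hn : 0 < n) {α β : ℝ} {Epst Eneg : Finset (Sym2 (Fin n))}
    {ω : ℕ → Sel n} (h : ∀ b : Fin n, Tendsto
      (fun k => spread (xproc α β Epst Eneg (Pi.single b 1) ω k)) atTop (nhds 0)) :
    Tendsto (fun k => Wprod α β Epst Eneg ω k) atTop (nhds (Umat n)) := by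
  refine tendsto_pi_nhds.2 fun a => tendsto_pi_nhds.2 fun b => ?_
  have h1 : ∀ k, Wprod α β Epst Eneg ω k a b =
      xproc α β Epst Eneg (Pi.single b 1) ω (k + 1) a := fun k => by
    rw [← Wprod_mulVec]; simp
  have h2 : Umat n a b = (n : ℝ)⁻¹ := by simp [Umat]
  rw [h2, funext h1, ← tendsto_sub_nhds_zero_iff]
  refine tendsto_of_sq_le (fun k => ?_) ((tendsto_add_atTop_iff_nat 1).2 (h b))
  simpa [sum_xproc] using
    sq_sub_mean_le_spread hn (xproc α β Epst Eneg (Pi.single b 1) ω (k + 1)) a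

lemma tendsto_diam_atTop_of_negPow {n : ℕ} (hn : 0 < n) {s : ℝ} (hs : 0 < s)
    {x : ℕ → Fin n → ℝ} (hx : ∀ k, 0 < spread (x k))
    (h : Tendsto (fun k => negPow s (x k)) atTop (nhds 0)) :
    Tendsto (fun k => diam (x k)) atTop atTop := by
  have hn' : (0 : ℝ) < n := by exact_mod_cast hn
  have h1 : Tendsto (fun k => negPow s (x k)) atTop (nhdsWithin 0 (Set.Ioi 0)) :=
    tendsto_nhdsWithin_iff.2 ⟨h, .of_forall fun k => Real.rpow_pos_of_pos (hx k) _⟩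
  have h2 : Tendsto (fun k => spread (x k)) atTop atTop := by
    refine ((tendsto_rpow_atTop (inv_pos.2 hs)).comp h1.inv_tendsto_nhdsGT_zero).congr fun k => ?_
    simp only [Function.comp_apply, Pi.inv_apply, negPow]
    rw [Real.rpow_neg (hx k).le, inv_inv, Real.rpow_rpow_inv (hx k).le hs.ne']
  have h3 : Tendsto (fun k => √(spread (x k)) / n) atTop atTop :=
    (Real.tendsto_sqrt_atTop.comp h2).atTop_div_const hn'
  refine tendsto_atTop_mono (fun k => ?_) h3
  rw [div_le_iff₀ hn', mul_comm]
  exact (Real.sqrt_le_left (mul_nonneg hn'.le (diam_nonneg hn _))).2 (spread_le_diam_sq _)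

theorem almost_sure_phase_transition
    (n : ℕ) (hn : 3 ≤ n)
    (Epst Eneg : Finset (Sym2 (Fin n)))
    (hdisj : Disjoint Epst Eneg)
    (hloop : ∀ e ∈ Epst ∪ Eneg, ¬ e.IsDiag)
    (P : Matrix (Fin n) (Fin n) ℝ)
    (hP : RowStochastic P)
    (hPc : Complies P (Epst ∪ Eneg))
    (hconn : (graphOf (Epst ∪ Eneg)).Connected)
    (hneg : Eneg.Nonempty)
    (hpconn : (graphOf Epst).Connected)
    (hpw : ∀ i j : Fin n, s(i, j) ∈ Epst ∪ Eneg → 0 < P i j + P j i)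
    (α : ℝ) (hα0 : 0 < α) (hα1 : α < 1) (hαhalf : α ≠ 1 / 2)
    (ℙ : Measure (ℕ → Sel n)) [IsProbabilityMeasure ℙ]
    (hiid : IsIIDSel ℙ P (Epst ∪ Eneg)) :
    (∃ βnat : ℝ, 0 < βnat ∧ ∀ β : ℝ, 0 ≤ β → β < βnat →
      ℙ {ω | Tendsto (fun k : ℕ => Wprod α β Epst Eneg ω k) atTop (nhds (Umat n))} = 1 ∧
      ∀ x0 : Fin n → ℝ,
        ℙ {ω | Tendsto (fun k : ℕ => diam (xproc α β Epst Eneg x0 ω k)) atTop (nhds 0)} = 1) ∧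
    (∃ βsharp : ℝ, 0 < βsharp ∧ ∀ β : ℝ, βsharp < β →
      ∀ x0 : Fin n → ℝ, 0 < diam x0 →
        ℙ {ω | Tendsto (fun k : ℕ => diam (xproc α β Epst Eneg x0 ω k)) atTop atTop} = 1) := by
  have hn0 : 0 < n := by omega
  set m : Sel n → ℝ := fun a => (seldist P (Epst ∪ Eneg) a).toReal with hmdef
  have hm : ∀ a, 0 ≤ m a := fun a => ENNReal.toReal_nonneg
  have hm1 : ∑ a, m a = 1 := sum_seldist hiid
  have hpos : ∀ e ∈ Epst ∪ Eneg, 0 < m (some e) := fun e he => seldist_some_pos hn0 hpw he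
  constructor
  · obtain ⟨βnat, hβnat, ρ, hρ0, hρ1, hcontract⟩ := exists_spread_contraction hn0 Eneg hpconn
      hα0 hα1 hm hm1 fun e he => hpos e (Finset.mem_union_left _ he)
    refine ⟨βnat, hβnat, fun β hβ hβ' => ?_⟩
    have hae : ∀ x0 : Fin n → ℝ, ∀ᵐ ω ∂ℙ,
        Tendsto (fun k => spread (xproc α β Epst Eneg x0 ω k)) atTop (nhds 0) := fun x0 => by
      refine ae_tendsto_zero_of_summable α β hiid x0 spread_nonneg ?_
      refine Summable.of_nonneg_of_le
        (fun k => iterate_stepAvg_nonneg hm _ spread_nonneg k x0) (fun k => ?_)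
        ((summable_geometric_of_lt_one hρ0 hρ1).mul_right (spread x0))
      simpa using iterate_stepAvg_le_pow hm (N := Set.univ) (fun _ _ _ => Set.mem_univ _)
        hρ0 1 (fun x _ => hcontract β hβ hβ' x) k x0 (Set.mem_univ _)
    constructor
    · apply prob_eq_one_of_ae
      filter_upwards [ae_all_iff.2 fun b : Fin n => hae (Pi.single b 1)] with ω hω
      exact tendsto_Wprod_of_spread hn0 hω
    · intro x0
      apply prob_eq_one_of_ae
      filter_upwards [hae x0] with ω hω
      exact tendsto_of_sq_le (fun k => diam_sq_le_spread hn0 _) (by simpa using hω.const_mul 2)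
  · obtain ⟨s, hs, βsharp, hβsharp, hsum⟩ := exists_summable_negPow hn0 hdisj hloop hneg hpconn
      hα0 hα1 hαhalf hm hm1 hpos
    refine ⟨βsharp, hβsharp, fun β hβ x0 hx0 => ?_⟩
    have hspread : 0 < spread x0 := by nlinarith [diam_sq_le_spread hn0 x0, pow_pos hx0 2]
    apply prob_eq_one_of_ae
    filter_upwards [ae_tendsto_zero_of_summable α β hiid x0 (negPow_nonneg s)
      (hsum β hβ x0 hspread)] with ω hω
    exact tendsto_diam_atTop_of_negPow hn0 hs
      (spread_xproc_pos hα0 hα1 hαhalf (hβsharp.trans hβ).le Epst Eneg hspread ω) hω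

end SignedOpinion
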